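/- arXiv:1009.1751 — 2 statements merged into one kernel-verified Lean document; each statement's English description precedes it below -/
import Mathlib

section
/- Let 0<p<∞. Then there is a positive real number C_p depending only on p such that E[max_{1≤j≤n} ω_j] ≥ C_p · (log(en))^{1/p} for all n ≥ 2. -/
open MeasureTheory Real Set
open scoped ENNReal

noncomputable section

/-- The `m`-th largest value among `|x_1|, …, |x_n|` (for `1 ≤ m ≤ n`). -/
def kthMax {ι : Type*} [Fintype ι] (x : ι → ℝ) (m : ℕ) : ℝ :=
  sSup {t : ℝ | ∃ S : Finset ι, m ≤ S.card ∧ ∀ j ∈ S, t ≤ |x j|}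

/-- The positive part `Δ_p^n` of the unit sphere of `ℓ_p^n`:
`Δ_p^n = {t ∈ [0,∞)^n : ∑_j t_j^p = 1}`. -/
def Delta (p : ℝ) (n : ℕ) : Set (Fin n → ℝ) :=
  {t | (∀ i, 0 ≤ t i) ∧ ∑ i, t i ^ p = 1}

/-- The cone `[0,1] · A = {t • a : t ∈ [0,1], a ∈ A}`. -/
def cone {n : ℕ} (A : Set (Fin n → ℝ)) : Set (Fin n → ℝ) :=
  {x | ∃ t ∈ Icc (0 : ℝ) 1, ∃ a ∈ A, x = t • a}

/-- `μ` is the normalized cone measure on `Δ_p^n`: it is a Borel probability measure with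
`μ(A) = λ([0,1]·A) / λ([0,1]·Δ_p^n)` for every Borel `A ⊆ Δ_p^n`. -/
def IsConeMeasure (p : ℝ) (n : ℕ) (μ : Measure (Fin n → ℝ)) : Prop :=
  IsProbabilityMeasure μ ∧
    ∀ A : Set (Fin n → ℝ), MeasurableSet A → A ⊆ Delta p n →
      μ A = volume (cone A) / volume (cone (Delta p n))

/-- The distribution on `[0,∞)` with density `c_p e^{-t^p}`, `c_p = p / Γ(1/p)`. -/
def expMeasure (p : ℝ) : Measure ℝ :=
  (volume.restrict (Ioi (0 : ℝ))).withDensity fun t =>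
    ENNReal.ofReal ((p / Real.Gamma (1 / p)) * Real.exp (-(t ^ p)))

/-- Joint distribution of `n` i.i.d. random variables with density `c_p e^{-t^p}` on `[0,∞)`. -/
def iidExp (p : ℝ) (n : ℕ) : Measure (Fin n → ℝ) := Measure.pi fun _ => expMeasure p


lemma em_cpos (p : ℝ) (hp : 0 < p) : 0 < p / Real.Gamma (1 / p) :=
  div_pos hp (Real.Gamma_pos_of_pos (by positivity))

lemma em_meas (p : ℝ) : Measurable fun t : ℝ =>
    ENNReal.ofReal ((p / Real.Gamma (1 / p)) * Real.exp (-(t ^ p))) := by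
  fun_prop

lemma em_prob (p : ℝ) (hp : 0 < p) : IsProbabilityMeasure (expMeasure p) := by
  constructor
  have hG : 0 < Real.Gamma (1 / p) := Real.Gamma_pos_of_pos (by positivity)
  have hI := integral_exp_neg_rpow hp
  rw [Real.Gamma_add_one (by positivity)] at hI
  have hint : Integrable (fun x : ℝ => Real.exp (-x ^ p)) (volume.restrict (Ioi 0)) := by
    apply Integrable.of_integral_ne_zero
    rw [hI]; positivity
  rw [expMeasure, withDensity_apply _ MeasurableSet.univ, Measure.restrict_univ,
    ← ofReal_integral_eq_lintegral_ofReal (hint.const_mul _)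
      (ae_of_all _ fun x => mul_nonneg (em_cpos p hp).le (Real.exp_pos _).le),
    integral_const_mul, hI]
  rw [show p / Real.Gamma (1 / p) * (1 / p * Real.Gamma (1 / p)) = 1 by field_simp]
  simp

lemma em_int (p : ℝ) (hp : 0 < p) : Integrable (fun x : ℝ => x) (expMeasure p) := by
  rw [expMeasure, integrable_withDensity_iff (em_meas p) (ae_of_all _ fun x => by simp)]
  have hI := integral_rpow_mul_exp_neg_rpow (q := 1) hp (by norm_num)
  have hG : 0 < Real.Gamma ((1 + 1) / p) := Real.Gamma_pos_of_pos (by positivity)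
  have hint : Integrable (fun x : ℝ => x ^ (1 : ℝ) * Real.exp (-x ^ p))
      (volume.restrict (Ioi 0)) := by
    apply Integrable.of_integral_ne_zero
    rw [hI]; positivity
  refine (hint.const_mul (p / Real.Gamma (1 / p))).congr (ae_of_all _ fun x => ?_)
  have := em_cpos p hp
  simp only [Real.rpow_one]
  rw [ENNReal.toReal_ofReal (by positivity)]
  ring

lemma em_pos (p : ℝ) : ∀ᵐ x ∂(expMeasure p), 0 < x := by
  apply (withDensity_absolutelyContinuous _ _).ae_le
  exact ae_restrict_mem measurableSet_Ioi

lemma em_tail (p : ℝ) (hp : 0 < p) (t : ℝ) (ht : 0 < t) :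
    p / Real.Gamma (1 / p) * Real.exp (-((2 * t) ^ p)) * t ≤ (expMeasure p).real (Ici t) := by
  have := em_prob p hp
  have hc := em_cpos p hp
  have h1 : ENNReal.ofReal (p / Real.Gamma (1 / p) * Real.exp (-((2 * t) ^ p)) * t)
      ≤ expMeasure p (Ioc t (2 * t)) := by
    rw [expMeasure, withDensity_apply _ measurableSet_Ioc,
      Measure.restrict_restrict measurableSet_Ioc,
      inter_eq_left.2 (fun x hx => mem_Ioi.2 (ht.trans hx.1))]
    calc _ = ∫⁻ _ in Ioc t (2 * t),
          ENNReal.ofReal (p / Real.Gamma (1 / p) * Real.exp (-((2 * t) ^ p))) := by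
          rw [setLIntegral_const, Real.volume_Ioc, ENNReal.ofReal_mul (by positivity)]
          congr 2; ring
      _ ≤ _ := by
          refine setLIntegral_mono' measurableSet_Ioc fun x hx => ?_
          have : x ^ p ≤ (2 * t) ^ p := Real.rpow_le_rpow (ht.trans hx.1).le hx.2 hp.le
          gcongr
  rw [measureReal_def, ← ENNReal.ofReal_le_iff_le_toReal (measure_ne_top _ _)]
  exact h1.trans (measure_mono fun x hx => hx.1.le)

lemma em_main (p : ℝ) (hp : 0 < p) (n : ℕ) (hn : 2 ≤ n) (t : ℝ) (ht : 0 < t) :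
    t * (1 - (1 - (expMeasure p).real (Ici t)) ^ n) ≤ ∫ ω, (⨆ j, ω j) ∂(iidExp p n) := by
  have := em_prob p hp
  have : IsProbabilityMeasure (iidExp p n) := by unfold iidExp; infer_instance
  have : Nonempty (Fin n) := ⟨⟨0, by omega⟩⟩
  have hbd : ∀ ω : Fin n → ℝ, BddAbove (range ω) := fun ω => (finite_range ω).bddAbove
  have hpos : ∀ᵐ ω ∂(iidExp p n), ∀ i, 0 < ω i := by
    rw [ae_all_iff]
    intro i
    exact (measurePreserving_eval (fun _ : Fin n => expMeasure p) i).quasiMeasurePreserving.ae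
      (em_pos p)
  have hsup : ∀ᵐ ω ∂(iidExp p n), 0 ≤ ⨆ j, ω j := by
    filter_upwards [hpos] with ω hω
    exact Real.iSup_nonneg fun i => (hω i).le
  have hint : Integrable (fun ω : Fin n → ℝ => ⨆ j, ω j) (iidExp p n) := by
    have hs : Integrable (fun ω : Fin n → ℝ => ∑ j, ω j) (iidExp p n) := by
      apply integrable_finsetSum
      intro i _
      exact (measurePreserving_eval (fun _ : Fin n => expMeasure p) i).integrable_comp_of_integrable
        (em_int p hp)
    refine hs.mono' (Measurable.iSup fun j => measurable_pi_apply j).aestronglyMeasurable ?_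
    filter_upwards [hpos, hsup] with ω hω h0
    rw [Real.norm_of_nonneg h0]
    exact ciSup_le fun j => Finset.single_le_sum (fun i _ => (hω i).le) (Finset.mem_univ j)
  refine le_trans ?_ (mul_meas_ge_le_integral_of_nonneg hsup hint t)
  refine mul_le_mul_of_nonneg_left ?_ ht.le
  have hm : MeasurableSet (Set.pi univ fun _ : Fin n => Iio t) :=
    MeasurableSet.univ_pi fun _ => measurableSet_Iio
  have h1 : (iidExp p n).real (Set.pi univ fun _ : Fin n => Iio t)
      = (1 - (expMeasure p).real (Ici t)) ^ n := by
    rw [← compl_Iio, probReal_compl_eq_one_sub measurableSet_Iio, sub_sub_cancel,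
      iidExp, measureReal_def, Measure.pi_pi]
    simp [measureReal_def]
  rw [← h1, ← probReal_compl_eq_one_sub hm]
  refine measureReal_mono ?_ (measure_ne_top _ _)
  intro ω hω
  simp only [mem_compl_iff, mem_pi, mem_univ, true_imp_iff, mem_Iio, not_forall, not_lt] at hω
  obtain ⟨i, hi⟩ := hω
  exact hi.trans (le_ciSup (hbd ω) i)

/-- For `0 < p < ∞` there is `C_p > 0` (depending only on `p`) such that
`E[max_{1≤j≤n} ω_j] ≥ C_p (log(e n))^{1/p}` for all `n ≥ 2`. -/
theorem expected_max_lower (p : ℝ) (hp : 0 < p) :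
    ∃ C : ℝ, 0 < C ∧ ∀ n : ℕ, 2 ≤ n →
      C * (Real.log (Real.exp 1 * n)) ^ (1 / p) ≤ ∫ ω, (⨆ j, ω j) ∂(iidExp p n) := by
  have hc := em_cpos p hp
  have := em_prob p hp
  set c := p / Real.Gamma (1 / p) with hcdef
  have hl2 : 0 < Real.log 2 := Real.log_pos (by norm_num)
  obtain ⟨δ, hδdef⟩ : ∃ δ, δ = c * (1 / 2 * (Real.log 2) ^ (1 / p)) := ⟨_, rfl⟩
  have hδ : 0 < δ := by rw [hδdef]; positivity
  have hE : 0 < 1 - Real.exp (-δ) := by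
    have : Real.exp (-δ) < 1 := by rw [← Real.exp_zero]; exact Real.exp_lt_exp.2 (by linarith)
    linarith
  refine ⟨1 / 2 * (1 - Real.exp (-δ)) * ((1 + 1 / Real.log 2) ^ (1 / p))⁻¹, by positivity, ?_⟩
  intro n hn
  have hnR : (2 : ℝ) ≤ n := by exact_mod_cast hn
  have hn0 : (0 : ℝ) < n := by linarith
  have hln : Real.log 2 ≤ Real.log n := Real.log_le_log (by norm_num) hnR
  have hln0 : 0 < Real.log n := by linarith
  obtain ⟨t, htdef⟩ : ∃ t, t = 1 / 2 * (Real.log n) ^ (1 / p) := ⟨_, rfl⟩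
  have ht : 0 < t := by rw [htdef]; positivity
  have h2t : (2 * t) ^ p = Real.log n := by
    rw [htdef, ← mul_assoc, show (2 : ℝ) * (1 / 2) = 1 by norm_num, one_mul,
      ← Real.rpow_mul hln0.le, one_div_mul_cancel hp.ne', Real.rpow_one]
  have htail := em_tail p hp t ht
  rw [h2t, Real.exp_neg, Real.exp_log hn0, ← hcdef] at htail
  have hq : δ / n ≤ (expMeasure p).real (Ici t) := by
    refine le_trans ?_ htail
    have : (Real.log 2) ^ (1 / p) ≤ (Real.log n) ^ (1 / p) :=
      Real.rpow_le_rpow hl2.le hln (by positivity)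
    rw [hδdef, htdef, div_eq_mul_inv, mul_right_comm]
    gcongr
  have hq1 : (expMeasure p).real (Ici t) ≤ 1 := measureReal_le_one
  have hpow : (1 - (expMeasure p).real (Ici t)) ^ n ≤ Real.exp (-δ) := by
    calc (1 - (expMeasure p).real (Ici t)) ^ n ≤ (Real.exp (-(δ / n))) ^ n := by
          refine pow_le_pow_left₀ (by linarith) ?_ n
          have := Real.add_one_le_exp (-(δ / n))
          linarith
      _ = Real.exp (-δ) := by
          rw [← Real.exp_nat_mul]
          congr 1
          field_simp
  refine le_trans ?_ (em_main p hp n hn t ht)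
  have hlog : (Real.log (Real.exp 1 * n)) ^ (1 / p)
      ≤ (1 + 1 / Real.log 2) ^ (1 / p) * (Real.log n) ^ (1 / p) := by
    rw [← Real.mul_rpow (by positivity) hln0.le, Real.log_mul (Real.exp_pos _).ne' hn0.ne',
      Real.log_exp]
    refine Real.rpow_le_rpow (by linarith) ?_ (by positivity)
    have : 1 ≤ 1 / Real.log 2 * Real.log n := by
      rw [one_div, ← div_eq_inv_mul, one_le_div hl2]; exact hln
    linarith
  have hK : 0 < (1 + 1 / Real.log 2) ^ (1 / p) := by positivity
  calc _ ≤ 1 / 2 * (1 - Real.exp (-δ)) * ((1 + 1 / Real.log 2) ^ (1 / p))⁻¹ *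
        ((1 + 1 / Real.log 2) ^ (1 / p) * (Real.log n) ^ (1 / p)) := by gcongr
    _ = t * (1 - Real.exp (-δ)) := by rw [htdef]; field_simp
    _ ≤ _ := by gcongr

end
end

section
/- Let 0<p<∞. There exist a number ε_p with 0 < ε_p < 1 and a positive real number C_p, both depending only on p, such that for all n ≥ 2 and all integers 0 ≤ m ≤ ε_p·n one has σ_m^{p,∞}(μ_p) = ∫_{Δ_p^n} x_{m+1}* dμ_p(x) ≥ C_p · (log(en/(m+1))/n)^{1/p}. -/
open MeasureTheory Real Set
open scoped ENNReal

noncomputable section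

/-- Facts about the set defining `kthMax`. -/
lemma kthMax_bdd {ι : Type*} [Fintype ι] (x : ι → ℝ) (m : ℕ) :
    BddAbove {t : ℝ | ∃ S : Finset ι, m + 1 ≤ S.card ∧ ∀ j ∈ S, t ≤ |x j|} := by
  refine ⟨∑ j, |x j|, ?_⟩
  rintro t ⟨S, hS, h⟩
  obtain ⟨j, hj⟩ : S.Nonempty := Finset.card_pos.mp (by omega)
  exact (h j hj).trans (Finset.single_le_sum (f := fun j => |x j|) (fun _ _ => abs_nonneg _) (Finset.mem_univ j))

lemma le_kthMax {ι : Type*} [Fintype ι] (x : ι → ℝ) (m : ℕ) (t : ℝ) (S : Finset ι)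
    (hS : m + 1 ≤ S.card) (h : ∀ j ∈ S, t ≤ |x j|) : t ≤ kthMax x (m + 1) :=
  le_csSup (kthMax_bdd x m) ⟨S, hS, h⟩

lemma kthMax_nonneg {n : ℕ} (x : Fin n → ℝ) (m : ℕ) (hm : m + 1 ≤ n) : 0 ≤ kthMax x (m + 1) :=
  le_kthMax x m 0 Finset.univ (by simpa using hm) (fun _ _ => abs_nonneg _)

lemma lt_kthMax_iff {n : ℕ} (x : Fin n → ℝ) (m : ℕ) (hm : m + 1 ≤ n) (c : ℝ) :
    c < kthMax x (m + 1) ↔ ∃ S : Finset (Fin n), m + 1 ≤ S.card ∧ ∀ j ∈ S, c < |x j| := by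
  unfold kthMax
  rw [lt_csSup_iff (kthMax_bdd x m) ⟨0, Finset.univ, by simpa using hm, fun _ _ => abs_nonneg _⟩]
  constructor
  · rintro ⟨b, ⟨S, hS, h⟩, hcb⟩
    exact ⟨S, hS, fun j hj => hcb.trans_le (h j hj)⟩
  · rintro ⟨S, hS, h⟩
    have hne : S.Nonempty := Finset.card_pos.mp (by omega)
    refine ⟨S.inf' hne (fun j => |x j|), ⟨S, hS, fun j hj => Finset.inf'_le _ hj⟩, ?_⟩
    rw [Finset.lt_inf'_iff]
    exact h

lemma kthMax_measurable {n : ℕ} (m : ℕ) (hm : m + 1 ≤ n) :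
    Measurable (fun x : Fin n → ℝ => kthMax x (m + 1)) := by
  apply measurable_of_Ioi
  intro c
  have : (fun x : Fin n → ℝ => kthMax x (m + 1)) ⁻¹' Ioi c =
      ⋃ S ∈ {S : Finset (Fin n) | m + 1 ≤ S.card}, ⋂ j ∈ S, {x | c < |x j|} := by
    ext x
    simp only [mem_preimage, mem_Ioi, lt_kthMax_iff x m hm, mem_iUnion, mem_iInter, mem_ofPred_eq,
      exists_prop]
  rw [this]
  refine MeasurableSet.biUnion (Set.to_countable _) fun S _ => ?_
  refine Finset.measurableSet_biInter _ fun j _ => ?_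
  exact measurableSet_lt measurable_const (by fun_prop)

lemma kthMax_le_one {p : ℝ} (hp : 0 < p) {n : ℕ} (x : Fin n → ℝ) (m : ℕ) (hm : m + 1 ≤ n)
    (hx : x ∈ Delta p n) : kthMax x (m + 1) ≤ 1 := by
  refine csSup_le ⟨0, Finset.univ, by simpa using hm, fun _ _ => abs_nonneg _⟩ ?_
  rintro t ⟨S, hS, h⟩
  obtain ⟨j, hj⟩ : S.Nonempty := Finset.card_pos.mp (by omega)
  refine (h j hj).trans ?_
  rw [abs_of_nonneg (hx.1 j)]
  by_contra hlt
  push Not at hlt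
  have h1 : 1 < x j ^ p := Real.one_lt_rpow hlt hp
  have h2 : x j ^ p ≤ ∑ i, x i ^ p :=
    Finset.single_le_sum (f := fun i => x i ^ p) (fun i _ => Real.rpow_nonneg (hx.1 i) _) (Finset.mem_univ j)
  rw [hx.2] at h2
  linarith

/-- Density on the line. -/
def phi (p b : ℝ) : ℝ → ℝ := (Ici (0 : ℝ)).indicator fun t => Real.exp (-b * t ^ p)

lemma phi_nonneg (p b t : ℝ) : 0 ≤ phi p b t := by
  unfold phi
  exact indicator_nonneg (fun _ _ => (Real.exp_pos _).le) _

lemma phi_integrable {p b : ℝ} (hp : 0 < p) (hb : 0 < b) : Integrable (phi p b) := by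
  unfold phi
  rw [integrable_indicator_iff measurableSet_Ici, integrableOn_Ici_iff_integrableOn_Ioi]
  have := integrableOn_rpow_mul_exp_neg_mul_rpow (s := 0) (by norm_num) hp hb
  simpa using this

lemma phi_integral_pos {p b : ℝ} (hp : 0 < p) (hb : 0 < b) : 0 < ∫ t, phi p b t := by
  unfold phi
  rw [integral_indicator measurableSet_Ici, integral_Ici_eq_integral_Ioi,
    integral_exp_neg_mul_rpow hp hb]
  have : 0 < Real.Gamma (1 / p + 1) := Real.Gamma_pos_of_pos (by positivity)
  positivity

lemma phi_tail {p v : ℝ} (hp : 0 < p) (hv : 0 ≤ v) :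
    Real.exp (-((2 : ℝ) ^ p * (v + 1))) ≤ ∫ t in {t : ℝ | v ≤ t ^ p}, phi p 1 t := by
  set u := v ^ (1 / p) with hu
  have hu0 : 0 ≤ u := by positivity
  have hup : u ^ p = v := by
    rw [hu, ← Real.rpow_mul hv]; simp [hp.ne']
  have hmeas : MeasurableSet {t : ℝ | v ≤ t ^ p} :=
    measurableSet_le measurable_const (by fun_prop)
  have hsub : Icc u (u + 1) ⊆ {t : ℝ | v ≤ t ^ p} := by
    intro t ht
    simp only [mem_ofPred_eq]
    rw [← hup]
    exact Real.rpow_le_rpow hu0 ht.1 hp.le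
  have h1 : ∫ t in Icc u (u + 1), phi p 1 t ≤ ∫ t in {t : ℝ | v ≤ t ^ p}, phi p 1 t := by
    apply setIntegral_mono_set (phi_integrable hp one_pos).integrableOn
    · exact Filter.Eventually.of_forall fun t => phi_nonneg p 1 t
    · exact hsub.eventuallyLE
  refine le_trans ?_ h1
  have h2 : ∫ t in Icc u (u + 1), Real.exp (-((2 : ℝ) ^ p * (v + 1))) ≤ ∫ t in Icc u (u + 1), phi p 1 t := by
    apply setIntegral_mono_on
    · simp
    · exact (phi_integrable hp one_pos).integrableOn
    · exact measurableSet_Icc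
    · intro t ht
      have ht0 : 0 ≤ t := hu0.trans ht.1
      unfold phi
      rw [indicator_of_mem (show t ∈ Ici (0:ℝ) from ht0)]
      apply Real.exp_le_exp.mpr
      have : t ^ p ≤ 2 ^ p * (v + 1) := by
        have h3 : t ^ p ≤ (2 * max u 1) ^ p := by
          apply Real.rpow_le_rpow ht0 _ hp.le
          have := le_max_left u 1
          have := le_max_right u 1
          linarith [ht.2]
        refine h3.trans ?_
        rw [Real.mul_rpow (by norm_num) (by positivity)]
        apply mul_le_mul_of_nonneg_left _ (by positivity)
        rcases le_total u 1 with h | h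
        · rw [max_eq_right h, Real.one_rpow]; linarith
        · rw [max_eq_left h, hup]; linarith
      linarith
  refine le_trans ?_ h2
  simp

/-- The nonnegative orthant. -/
def orth (n : ℕ) : Set (Fin n → ℝ) := {x | ∀ i, 0 ≤ x i}

lemma orth_measurable (n : ℕ) : MeasurableSet (orth n) := by
  have : orth n = ⋂ i, {x | 0 ≤ x i} := by ext; simp [orth]
  rw [this]
  exact MeasurableSet.iInter fun i => measurableSet_le measurable_const (by fun_prop)

lemma prod_phi {p b : ℝ} {n : ℕ} (x : Fin n → ℝ) (hx : x ∈ orth n) :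
    ∏ i, phi p b (x i) = Real.exp (-b * ∑ i, x i ^ p) := by
  rw [Finset.mul_sum, Real.exp_sum]
  refine Finset.prod_congr rfl fun i _ => ?_
  unfold phi
  rw [indicator_of_mem (show x i ∈ Ici (0:ℝ) from hx i)]

/-- unit ball part. -/
def Kset (p : ℝ) (n : ℕ) : Set (Fin n → ℝ) := {x | ∑ i, x i ^ p ≤ 1}

lemma g_smul {p : ℝ} {n : ℕ} (r : ℝ) (hr : 0 ≤ r) (x : Fin n → ℝ) (hx : x ∈ orth n) :
    ∑ i, (r • x) i ^ p = r ^ p * ∑ i, x i ^ p := by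
  rw [Finset.mul_sum]
  refine Finset.sum_congr rfl fun i _ => ?_
  simp [Real.mul_rpow hr (hx i)]

open scoped Pointwise in
/-- Layer cake representation for cones. -/
lemma layer (p : ℝ) (hp : 0 < p) (n : ℕ) : ∃ c : ℝ≥0∞, ∀ B : Set (Fin n → ℝ), MeasurableSet B →
    B ⊆ orth n → (∀ r : ℝ, 0 < r → ∀ x ∈ B, r • x ∈ B) →
    ∫⁻ x in B, ENNReal.ofReal (∏ i, phi p 1 (x i)) = c * volume (B ∩ Kset p n) := by
  set h : ℝ → ℝ≥0∞ := fun t => if t < 1 then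
    ENNReal.ofReal |((-Real.log t) ^ (1 / p)) ^ n| else 0 with hh
  have hmeas : Measurable h := by
    apply Measurable.ite measurableSet_Iio _ measurable_const
    fun_prop
  refine ⟨∫⁻ t in Ioi 0, h t, fun B hB hBo hBr => ?_⟩
  have e1 : ∫⁻ x in B, ENNReal.ofReal (∏ i, phi p 1 (x i)) =
      ∫⁻ x in B, ENNReal.ofReal (Real.exp (-∑ i, x i ^ p)) := by
    refine setLIntegral_congr_fun hB fun x hx => ?_
    rw [prod_phi x (hBo hx)]
    simp
  rw [e1, lintegral_eq_lintegral_meas_le _ (Filter.Eventually.of_forall fun x => (Real.exp_pos _).le)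
    (Measurable.aemeasurable (by fun_prop)), ← lintegral_mul_const _ hmeas]
  apply lintegral_congr_ae
  have hne : ∀ᵐ t : ℝ ∂(volume.restrict (Ioi 0)), t ≠ 1 := by
    apply ae_restrict_of_ae
    exact (measure_eq_zero_iff_ae_notMem.mp (Real.volume_singleton (a := 1))).mono fun t ht => by simpa using ht
  filter_upwards [hne, ae_restrict_mem measurableSet_Ioi] with t ht ht0
  simp only [mem_Ioi] at ht0
  rw [Measure.restrict_apply (measurableSet_le measurable_const (by fun_prop))]
  simp only [hh]
  split_ifs with h1
  · have hl : 0 < -Real.log t := by linarith [Real.log_neg ht0 h1]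
    set r := (-Real.log t) ^ (1 / p) with hr
    have hr0 : 0 < r := by positivity
    have hrp : r ^ p = -Real.log t := by
      rw [hr, ← Real.rpow_mul hl.le]; simp [hp.ne']
    have key : ({a : Fin n → ℝ | t ≤ Real.exp (-∑ i, a i ^ p)} ∩ B) = r • (B ∩ Kset p n) := by
      ext x
      rw [mem_smul_set_iff_inv_smul_mem₀ hr0.ne']
      have hiff : x ∈ B ↔ r⁻¹ • x ∈ B := by
        refine ⟨fun hx => hBr _ (by positivity) x hx, fun hx => ?_⟩
        have := hBr r hr0 _ hx
        rwa [smul_inv_smul₀ hr0.ne'] at this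
      simp only [mem_inter_iff, mem_ofPred_eq, ← hiff, Kset]
      rw [and_comm]
      refine and_congr_right fun hx => ?_
      rw [g_smul r⁻¹ (by positivity) x (hBo hx), ← Real.log_le_iff_le_exp ht0,
        Real.inv_rpow hr0.le, hrp, inv_mul_le_iff₀ hl]
      constructor <;> intro h <;> linarith
    rw [key, Measure.addHaar_smul]
    simp
  · have : ({a : Fin n → ℝ | t ≤ Real.exp (-∑ i, a i ^ p)} ∩ B) = ∅ := by
      ext x
      simp only [mem_inter_iff, mem_ofPred_eq, mem_empty_iff_false, iff_false, not_and]
      intro h2 hx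
      have h3 : 0 ≤ ∑ i, x i ^ p := Finset.sum_nonneg fun i _ => Real.rpow_nonneg (hBo hx i) _
      have h4 : Real.exp (-∑ i, x i ^ p) ≤ 1 := Real.exp_le_one_iff.mpr (by linarith)
      exact ht (le_antisymm (h2.trans h4) (not_lt.mp h1))
    simp [this]

lemma Delta_measurable (p : ℝ) (n : ℕ) : MeasurableSet (Delta p n) := by
  have : Delta p n = orth n ∩ {x | ∑ i, x i ^ p = 1} := rfl
  rw [this]
  exact (orth_measurable n).inter (measurableSet_eq_fun (by fun_prop) measurable_const)

lemma W_nonneg (p b : ℝ) {n : ℕ} (x : Fin n → ℝ) : 0 ≤ ∏ i, phi p b (x i) :=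
  Finset.prod_nonneg fun i _ => phi_nonneg p b (x i)

lemma W_zero (p b : ℝ) {n : ℕ} (x : Fin n → ℝ) (hx : x ∉ orth n) : ∏ i, phi p b (x i) = 0 := by
  simp only [orth, mem_ofPred_eq, not_forall] at hx
  obtain ⟨i, hi⟩ := hx
  refine Finset.prod_eq_zero (Finset.mem_univ i) ?_
  unfold phi
  exact indicator_of_notMem hi _

lemma W_integrable {p b : ℝ} (hp : 0 < p) (hb : 0 < b) (n : ℕ) :
    Integrable (fun x : Fin n → ℝ => ∏ i, phi p b (x i)) :=
  Integrable.fintype_prod (f := fun _ => phi p b) fun _ => phi_integrable hp hb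

lemma W_integral (p b : ℝ) (n : ℕ) :
    ∫ x : Fin n → ℝ, ∏ i, phi p b (x i) = (∫ t, phi p b t) ^ n := by
  simpa using integral_fintype_prod_volume_eq_pow (ι := Fin n) (phi p b)

lemma W_integral_orth (p b : ℝ) (n : ℕ) :
    ∫ x in orth n, ∏ i, phi p b (x i) = (∫ t, phi p b t) ^ n := by
  rw [← W_integral, setIntegral_eq_integral_of_forall_compl_eq_zero]
  exact fun x hx => W_zero p b x hx

lemma cone_lower {p : ℝ} (hp : 0 < p) {n : ℕ} {μ : Measure (Fin n → ℝ)}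
    (hμ : IsConeMeasure p n μ) (A B : Set (Fin n → ℝ)) (hA : MeasurableSet A) (hAD : A ⊆ Delta p n)
    (hB : MeasurableSet B) (hBo : B ⊆ orth n) (hB0 : (0 : Fin n → ℝ) ∉ B)
    (hBr : ∀ r : ℝ, 0 < r → ∀ x ∈ B, r • x ∈ B) (hBA : B ∩ Delta p n ⊆ A) (δ : ℝ) (hδ : 0 ≤ δ)
    (hIntg : δ * (∫ t, phi p 1 t) ^ n ≤ ∫ x in B, ∏ i, phi p 1 (x i)) :
    ENNReal.ofReal δ ≤ μ A := by
  have hZ := phi_integral_pos (b := 1) hp one_pos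
  obtain ⟨c, hc⟩ := layer p hp n
  have key : ∀ D : Set (Fin n → ℝ), ∫⁻ x in D, ENNReal.ofReal (∏ i, phi p 1 (x i)) =
      ENNReal.ofReal (∫ x in D, ∏ i, phi p 1 (x i)) := by
    intro D
    rw [ofReal_integral_eq_lintegral_ofReal (W_integrable hp one_pos n).integrableOn]
    exact Filter.Eventually.of_forall fun x => W_nonneg p 1 x
  have e1 := hc (orth n) (orth_measurable n) subset_rfl
    (fun r hr x hx i => mul_nonneg hr.le (hx i))
  rw [key, W_integral_orth] at e1
  have e2 := hc B hB hBo hBr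
  rw [key] at e2
  have hpos : ENNReal.ofReal ((∫ t, phi p 1 t) ^ n) ≠ 0 := by
    simp only [ne_eq, ENNReal.ofReal_eq_zero, not_le]; positivity
  have hv0 : volume (orth n ∩ Kset p n) ≠ 0 := by
    intro h; rw [h, mul_zero] at e1; exact hpos e1
  have hc0 : c ≠ 0 := by
    intro h; rw [h, zero_mul] at e1; exact hpos e1
  have hct : c ≠ ∞ := by
    intro h; rw [h, ENNReal.top_mul hv0] at e1; exact ENNReal.ofReal_ne_top e1
  have hvt : volume (orth n ∩ Kset p n) ≠ ∞ := by
    intro h; rw [h, ENNReal.mul_top hc0] at e1; exact ENNReal.ofReal_ne_top e1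
  have s1 : B ∩ Kset p n ⊆ cone A := by
    rintro x ⟨hxB, hxK⟩
    have hxo := hBo hxB
    have hg0 : 0 < ∑ i, x i ^ p := by
      obtain ⟨i, hi⟩ : ∃ i, x i ≠ 0 := by
        by_contra h
        push Not at h
        exact hB0 ((funext h : x = 0) ▸ hxB)
      refine Finset.sum_pos' (fun i _ => Real.rpow_nonneg (hxo i) _) ⟨i, Finset.mem_univ i, ?_⟩
      exact Real.rpow_pos_of_pos (lt_of_le_of_ne (hxo i) hi.symm) _
    set r := (∑ i, x i ^ p) ^ (1 / p) with hr
    have hr0 : 0 < r := by positivity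
    have hrp : r ^ p = ∑ i, x i ^ p := by
      rw [hr, ← Real.rpow_mul hg0.le]; simp [hp.ne']
    have hr1 : r ≤ 1 := Real.rpow_le_one hg0.le hxK (by positivity)
    refine ⟨r, ⟨hr0.le, hr1⟩, r⁻¹ • x, hBA ⟨hBr _ (by positivity) x hxB, ?_, ?_⟩, ?_⟩
    · exact fun i => mul_nonneg (by positivity) (hxo i)
    · rw [g_smul r⁻¹ (by positivity) x hxo, Real.inv_rpow hr0.le, hrp, inv_mul_cancel₀ hg0.ne']
    · rw [smul_inv_smul₀ hr0.ne']
  have s2 : cone (Delta p n) ⊆ orth n ∩ Kset p n := by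
    rintro x ⟨t, ht, a, ha, rfl⟩
    refine ⟨fun i => mul_nonneg ht.1 (ha.1 i), ?_⟩
    change ∑ i, (t • a) i ^ p ≤ 1
    rw [g_smul t ht.1 a ha.1, ha.2, mul_one]
    exact Real.rpow_le_one ht.1 ht.2 hp.le
  rw [hμ.2 A hA hAD]
  refine le_trans ?_ (ENNReal.div_le_div (measure_mono s1) (measure_mono s2))
  rw [ENNReal.le_div_iff_mul_le (Or.inl hv0) (Or.inl hvt)]
  rw [← ENNReal.mul_le_mul_iff_right hc0 hct, ← e2, mul_left_comm, ← e1, ← ENNReal.ofReal_mul hδ]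
  exact ENNReal.ofReal_le_ofReal hIntg

lemma cone_Delta {p : ℝ} (hp : 0 < p) {n : ℕ} (hn : 2 ≤ n) {μ : Measure (Fin n → ℝ)}
    (hμ : IsConeMeasure p n μ) : μ (Delta p n) = 1 := by
  haveI := hμ.1
  haveI : Nonempty (Fin n) := ⟨⟨0, by omega⟩⟩
  refine le_antisymm prob_le_one ?_
  rw [← ENNReal.ofReal_one]
  refine cone_lower hp hμ (Delta p n) (orth n \ {0}) (Delta_measurable p n) subset_rfl
    ((orth_measurable n).diff (measurableSet_singleton 0)) diff_subset (by simp) ?_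
    inter_subset_right 1 zero_le_one ?_
  · rintro r hr x ⟨hx, hx0⟩
    refine ⟨fun i => mul_nonneg hr.le (hx i), ?_⟩
    simpa [hr.ne'] using hx0
  · rw [one_mul, ← W_integral_orth]
    refine le_of_eq (setIntegral_congr_set ?_)
    exact (diff_null_ae_eq_self (measure_singleton _)).symm

lemma int_lower {p : ℝ} (hp : 0 < p) {n m : ℕ} (hn : 2 ≤ n) (hm : m + 1 ≤ n)
    {μ : Measure (Fin n → ℝ)} (hμ : IsConeMeasure p n μ) (A : Set (Fin n → ℝ))
    (hA : MeasurableSet A) (s : ℝ) (hs : 0 ≤ s)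
    (h : ∀ x ∈ A, s ≤ kthMax x (m + 1)) (hμA : ENNReal.ofReal (1 / 2) ≤ μ A) :
    1 / 2 * s ≤ ∫ x, kthMax x (m + 1) ∂μ := by
  haveI := hμ.1
  have hae : ∀ᵐ x ∂μ, x ∈ Delta p n :=
    (prob_compl_eq_zero_iff (Delta_measurable p n)).mpr (cone_Delta hp hn hμ)
  have hIntg : Integrable (fun x => kthMax x (m + 1)) μ := by
    refine Integrable.of_bound (kthMax_measurable m hm).aestronglyMeasurable 1 ?_
    filter_upwards [hae] with x hx
    rw [Real.norm_of_nonneg (kthMax_nonneg x m hm)]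
    exact kthMax_le_one hp x m hm hx
  have h1 : (1 / 2 : ℝ) ≤ μ.real A := by
    rw [Measure.real, ← ENNReal.ofReal_le_iff_le_toReal (measure_ne_top _ _)]
    exact hμA
  calc 1 / 2 * s ≤ μ.real A * s := mul_le_mul_of_nonneg_right h1 hs
    _ = ∫ x in A, s ∂μ := by simp
    _ ≤ ∫ x in A, kthMax x (m + 1) ∂μ := 
        setIntegral_mono_on (by simp) hIntg.integrableOn hA h
    _ ≤ ∫ x, kthMax x (m + 1) ∂μ := 
        setIntegral_le_integral hIntg (Filter.Eventually.of_forall fun x => kthMax_nonneg x m hm)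

/-- The cone of vectors with many large coordinates. -/
def Bset (p θ : ℝ) (n m : ℕ) : Set (Fin n → ℝ) :=
  {x | (x ∈ orth n ∧ x ≠ 0) ∧ ∃ S : Finset (Fin n), m + 1 ≤ S.card ∧
    ∀ j ∈ S, θ * ∑ i, x i ^ p ≤ x j ^ p}

lemma Bset_measurable (p θ : ℝ) (n m : ℕ) : MeasurableSet (Bset p θ n m) := by
  have : Bset p θ n m = (orth n \ {0}) ∩
      ⋃ S ∈ {S : Finset (Fin n) | m + 1 ≤ S.card}, ⋂ j ∈ S,
        {x : Fin n → ℝ | θ * ∑ i, x i ^ p ≤ x j ^ p} := by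
    ext x
    simp [Bset]
  rw [this]
  refine ((orth_measurable n).diff (measurableSet_singleton 0)).inter ?_
  refine MeasurableSet.biUnion (Set.to_countable _) fun S _ => ?_
  refine Finset.measurableSet_biInter _ fun j _ => ?_
  exact measurableSet_le (by fun_prop) (by fun_prop)

/-- Main probabilistic estimate. -/
lemma good {p : ℝ} (hp : 0 < p) {n m : ℕ} (hn : 1 ≤ n) {v K : ℝ} (hv : 0 < v) (hK : 0 < K)
    (hKM : Real.exp (-K / 2) * (∫ t, phi p (1 / 2) t) ≤ (∫ t, phi p 1 t) / 4)
    (hQ : 4 * ((m : ℝ) + 1) * (∫ t, phi p 1 t) ≤ n * ∫ t in {t : ℝ | v ≤ t ^ p}, phi p 1 t) :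
    1 / 2 * (∫ t, phi p 1 t) ^ n ≤ ∫ x in Bset p (v / (K * n)) n m, ∏ i, phi p 1 (x i) := by
  have hn0 : (0 : ℝ) < n := by exact_mod_cast hn
  set Z := ∫ t, phi p 1 t with hZdef
  have hZ : 0 < Z := phi_integral_pos hp one_pos
  set M := ∫ t, phi p (1 / 2) t with hMdef
  have hM : 0 < M := phi_integral_pos hp (by norm_num)
  set T := {t : ℝ | v ≤ t ^ p} with hT
  have hTm : MeasurableSet T := measurableSet_le measurable_const (by fun_prop)
  set Q := ∫ t in T, phi p 1 t with hQdef
  have hQ0 : 0 ≤ Q := integral_nonneg fun t => phi_nonneg p 1 t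
  set f : ℝ → ℝ := fun t => phi p 1 t - (1 - Real.exp (-1)) * T.indicator (phi p 1) t with hf
  have hTi : Integrable (T.indicator (phi p 1)) := (phi_integrable hp one_pos).indicator hTm
  have hfint : Integrable f := (phi_integrable hp one_pos).sub (hTi.const_mul _)
  have hf1 : ∫ t, f t = Z - (1 - Real.exp (-1)) * Q := by
    rw [hf, integral_sub (phi_integrable hp one_pos) (hTi.const_mul _), integral_const_mul,
      integral_indicator hTm]
  have hft : ∀ t, f t = phi p 1 t * Real.exp (-(T.indicator (fun _ => (1 : ℝ)) t)) := by
    intro t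
    by_cases ht : t ∈ T
    · simp only [hf, indicator_of_mem ht]; ring
    · simp [hf, indicator_of_notMem ht]
  have hf0 : ∀ t, 0 ≤ f t := fun t => by
    rw [hft]; exact mul_nonneg (phi_nonneg _ _ _) (Real.exp_pos _).le
  have hFint : Integrable (fun x : Fin n → ℝ => ∏ i, f (x i)) :=
    Integrable.fintype_prod (f := fun _ => f) fun _ => hfint
  have hF1 : ∫ x : Fin n → ℝ, ∏ i, f (x i) = (∫ t, f t) ^ n := by
    simpa using integral_fintype_prod_volume_eq_pow (ι := Fin n) f
  have hBm := Bset_measurable p (v / (K * n)) n m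
  have hpt : ∀ x : Fin n → ℝ, ∏ i, phi p 1 (x i) ≤
      ((Bset p (v / (K * n)) n m).indicator (fun x => ∏ i, phi p 1 (x i)) x
        + Real.exp m * ∏ i, f (x i)) + Real.exp (-(K * n) / 2) * ∏ i, phi p (1 / 2) (x i) := by
    intro x
    have t1 : 0 ≤ (Bset p (v / (K * n)) n m).indicator (fun x => ∏ i, phi p 1 (x i)) x :=
      indicator_nonneg (fun x _ => W_nonneg p 1 x) x
    have t2 : 0 ≤ Real.exp m * ∏ i, f (x i) :=
      mul_nonneg (Real.exp_pos _).le (Finset.prod_nonneg fun i _ => hf0 _)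
    have t3 : 0 ≤ Real.exp (-(K * n) / 2) * ∏ i, phi p (1 / 2) (x i) :=
      mul_nonneg (Real.exp_pos _).le (W_nonneg _ _ _)
    by_cases hxo : x ∈ orth n
    swap
    · rw [W_zero p 1 x hxo]; linarith
    by_cases hg : K * n < ∑ i, x i ^ p
    · have : ∏ i, phi p 1 (x i) ≤ Real.exp (-(K * n) / 2) * ∏ i, phi p (1 / 2) (x i) := by
        rw [prod_phi x hxo, prod_phi x hxo, ← Real.exp_add]
        apply Real.exp_le_exp.mpr
        linarith
      linarith
    push Not at hg
    classical
    set S := Finset.univ.filter fun i => x i ∈ T with hS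
    by_cases hc : m + 1 ≤ S.card
    · have hxB : x ∈ Bset p (v / (K * n)) n m := by
        refine ⟨⟨hxo, ?_⟩, S, hc, ?_⟩
        · rintro rfl
          obtain ⟨j, hj⟩ : S.Nonempty := Finset.card_pos.mp (by omega)
          have hj2 : v ≤ (0 : ℝ) ^ p := (Finset.mem_filter.mp hj).2
          rw [Real.zero_rpow hp.ne'] at hj2
          linarith
        · intro j hj
          have hj2 : v ≤ x j ^ p := (Finset.mem_filter.mp hj).2
          refine le_trans ?_ hj2
          rw [div_mul_eq_mul_div, div_le_iff₀ (by positivity)]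
          exact mul_le_mul_of_nonneg_left hg hv.le
      rw [indicator_of_mem hxB]
      linarith
    · have hsum : ∑ i, T.indicator (fun _ => (1 : ℝ)) (x i) = S.card := by
        simp [hS, indicator_apply, Finset.sum_ite]
      have : ∏ i, phi p 1 (x i) ≤ Real.exp m * ∏ i, f (x i) := by
        simp_rw [hft]
        rw [Finset.prod_mul_distrib, ← Real.exp_sum, Finset.sum_neg_distrib, hsum, mul_left_comm,
          ← Real.exp_add]
        apply le_mul_of_one_le_right (W_nonneg _ _ _)
        apply Real.one_le_exp
        have : (S.card : ℝ) ≤ m := by exact_mod_cast (by omega : S.card ≤ m)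
        linarith
      linarith
  have hi1 := (W_integrable (n := n) hp one_pos).indicator hBm
  have hi2 := hFint.const_mul (Real.exp m)
  have hi3 := (W_integrable (n := n) (b := 1 / 2) hp (by norm_num)).const_mul (Real.exp (-(K * n) / 2))
  have hmono := integral_mono (W_integrable (n := n) hp one_pos) ((hi1.add hi2).add hi3) hpt
  rw [W_integral] at hmono
  simp only [Pi.add_apply] at hmono
  rw [integral_add (by exact hi1.add hi2) hi3, integral_add hi1 hi2, integral_const_mul,
    integral_const_mul, integral_indicator hBm, hF1, hf1, W_integral] at hmono
  -- first bad event
  have hexp1 : Real.exp (-1) ≤ 1 / 2 := by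
    have := Real.exp_one_gt_d9
    rw [Real.exp_neg, inv_le_comm₀ (Real.exp_pos _) (by norm_num)]
    norm_num; linarith
  have b1 : Real.exp m * (Z - (1 - Real.exp (-1)) * Q) ^ n ≤ Z ^ n / 4 := by
    have h0 : 0 ≤ Z - (1 - Real.exp (-1)) * Q := by
      rw [← hf1]; exact integral_nonneg hf0
    have h1 : Z - (1 - Real.exp (-1)) * Q ≤ Z * Real.exp (-(Q / (2 * Z))) := by
      have h2 := Real.add_one_le_exp (-(Q / (2 * Z)))
      have h3 : Z * (-(Q / (2 * Z)) + 1) = Z - Q / 2 := by field_simp; ring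
      have h4 := mul_le_mul_of_nonneg_left h2 hZ.le
      rw [h3] at h4
      nlinarith
    have h5 : (Z - (1 - Real.exp (-1)) * Q) ^ n ≤ Z ^ n * Real.exp (-(n * Q / (2 * Z))) := by
      refine (pow_le_pow_left₀ h0 h1 n).trans (le_of_eq ?_)
      rw [mul_pow, ← Real.exp_nat_mul]
      congr 2; ring
    have h6 : 2 * ((m : ℝ) + 1) ≤ n * Q / (2 * Z) := by
      rw [le_div_iff₀ (by positivity)]; linarith
    calc Real.exp m * (Z - (1 - Real.exp (-1)) * Q) ^ n
        ≤ Real.exp m * (Z ^ n * Real.exp (-(n * Q / (2 * Z)))) :=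
          mul_le_mul_of_nonneg_left h5 (Real.exp_pos _).le
      _ = Z ^ n * Real.exp (m - n * Q / (2 * Z)) := by
          rw [sub_eq_add_neg, Real.exp_add]; ring
      _ ≤ Z ^ n * Real.exp (-1 + -1) := by
          apply mul_le_mul_of_nonneg_left _ (by positivity)
          apply Real.exp_le_exp.mpr
          have : (0 : ℝ) ≤ m := Nat.cast_nonneg m
          linarith
      _ ≤ Z ^ n * (1 / 4) := by
          apply mul_le_mul_of_nonneg_left _ (by positivity)
          rw [Real.exp_add]
          nlinarith [Real.exp_pos (-1)]
      _ = Z ^ n / 4 := by ring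
  have b2 : Real.exp (-(K * n) / 2) * M ^ n ≤ Z ^ n / 4 := by
    have : Real.exp (-(K * n) / 2) * M ^ n = (Real.exp (-K / 2) * M) ^ n := by
      rw [mul_pow, ← Real.exp_nat_mul]
      congr 2; ring
    rw [this]
    calc (Real.exp (-K / 2) * M) ^ n ≤ (Z / 4) ^ n := pow_le_pow_left₀ (by positivity) hKM n
      _ = Z ^ n * (1 / 4) ^ n := by rw [← mul_pow]; congr 1; ring
      _ ≤ Z ^ n * (1 / 4) ^ 1 := by
          apply mul_le_mul_of_nonneg_left _ (by positivity)
          exact pow_le_pow_of_le_one (by norm_num) (by norm_num) hn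
      _ = Z ^ n / 4 := by ring
  linarith

lemma main_case {p : ℝ} (hp : 0 < p) {n m : ℕ} (hn : 2 ≤ n) (hm : m + 1 ≤ n) {v K : ℝ}
    (hv : 0 < v) (hK : 0 < K)
    (hKM : Real.exp (-K / 2) * (∫ t, phi p (1 / 2) t) ≤ (∫ t, phi p 1 t) / 4)
    (hQ : 4 * ((m : ℝ) + 1) * (∫ t, phi p 1 t) ≤ n * ∫ t in {t : ℝ | v ≤ t ^ p}, phi p 1 t)
    {μ : Measure (Fin n → ℝ)} (hμ : IsConeMeasure p n μ) :
    1 / 2 * (v / (K * n)) ^ (1 / p) ≤ ∫ x, kthMax x (m + 1) ∂μ := by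
  have hn0 : (0 : ℝ) < n := by exact_mod_cast (by omega : 0 < n)
  have hθ : 0 < v / (K * n) := by positivity
  have hBm := Bset_measurable p (v / (K * n)) n m
  refine int_lower hp hn hm hμ (Bset p (v / (K * n)) n m ∩ Delta p n)
    (hBm.inter (Delta_measurable p n)) _ (by positivity) ?_ ?_
  · rintro x ⟨⟨_, S, hS, h⟩, hx⟩
    refine le_kthMax x m _ S hS fun j hj => ?_
    have h1 := h j hj
    rw [hx.2, mul_one] at h1
    rw [abs_of_nonneg (hx.1 j)]
    have h2 := Real.rpow_le_rpow hθ.le h1 (show 0 ≤ 1 / p by positivity)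
    rwa [← Real.rpow_mul (hx.1 j), mul_one_div_cancel hp.ne', Real.rpow_one] at h2
  · refine cone_lower hp hμ _ (Bset p (v / (K * n)) n m) (hBm.inter (Delta_measurable p n))
      inter_subset_right hBm (fun x hx => hx.1.1) (fun h => h.1.2 rfl) ?_ subset_rfl _ (by norm_num)
      (good hp (by omega) hv hK hKM hQ)
    rintro r hr x ⟨⟨hxo, hx0⟩, S, hS, h⟩
    refine ⟨⟨fun i => mul_nonneg hr.le (hxo i), by simpa [hr.ne'] using hx0⟩, S, hS, fun j hj => ?_⟩
    rw [g_smul r hr.le x hxo]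
    have : (r • x) j ^ p = r ^ p * x j ^ p := by simp [Real.mul_rpow hr.le (hxo j)]
    rw [this, mul_left_comm]
    exact mul_le_mul_of_nonneg_left (h j hj) (by positivity)

lemma small_case {p : ℝ} (hp : 0 < p) {n : ℕ} (hn : 2 ≤ n)
    {μ : Measure (Fin n → ℝ)} (hμ : IsConeMeasure p n μ) :
    1 / 2 * (1 / (n : ℝ)) ^ (1 / p) ≤ ∫ x, kthMax x (0 + 1) ∂μ := by
  have hn0 : (0 : ℝ) < n := by exact_mod_cast (by omega : 0 < n)
  refine int_lower hp hn (by omega) hμ (Delta p n) (Delta_measurable p n) _ (by positivity) ?_ ?_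
  · intro x hx
    obtain ⟨j, hj⟩ : ∃ j, 1 / (n : ℝ) ≤ x j ^ p := by
      by_contra h
      push Not at h
      haveI : Nonempty (Fin n) := ⟨⟨0, by omega⟩⟩
      have h1 : ∑ i, x i ^ p < ∑ i : Fin n, 1 / (n : ℝ) :=
        Finset.sum_lt_sum_of_nonempty Finset.univ_nonempty fun i _ => h i
      rw [hx.2] at h1
      simp [hn0.ne'] at h1
    refine le_kthMax x 0 _ {j} (by simp) fun i hi => ?_
    rw [Finset.mem_singleton.mp hi, abs_of_nonneg (hx.1 j)]
    have h2 := Real.rpow_le_rpow (by positivity) hj (show 0 ≤ 1 / p by positivity)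
    rwa [← Real.rpow_mul (hx.1 j), mul_one_div_cancel hp.ne', Real.rpow_one] at h2
  · rw [cone_Delta hp hn hμ, ← ENNReal.ofReal_one]
    exact ENNReal.ofReal_le_ofReal (by norm_num)

/-- For `0 < p < ∞` there are `ε_p ∈ (0,1)` and `C_p > 0`, both depending only on `p`, such
that for all `n ≥ 2` and all integers `0 ≤ m ≤ ε_p n`,
`σ_m^{p,∞}(μ_p) = ∫_{Δ_p^n} x_{m+1}^* dμ_p(x) ≥ C_p (log(en/(m+1))/n)^{1/p}`. -/
theorem average_best_m_term_width_cone_lower (p : ℝ) (hp : 0 < p) :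
    ∃ ε C : ℝ, 0 < ε ∧ ε < 1 ∧ 0 < C ∧
      ∀ n : ℕ, 2 ≤ n → ∀ m : ℕ, (m : ℝ) ≤ ε * n →
        ∀ μ : Measure (Fin n → ℝ), IsConeMeasure p n μ →
          C * (Real.log (Real.exp 1 * n / ((m : ℝ) + 1)) / n) ^ (1 / p)
            ≤ ∫ x, kthMax x (m + 1) ∂μ := by
  set Z := ∫ t, phi p 1 t with hZdef
  have hZ : 0 < Z := phi_integral_pos hp one_pos
  set M := ∫ t, phi p (1 / 2) t with hMdef
  have hM : 0 < M := phi_integral_pos hp (by norm_num)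
  set D : ℝ := (2 : ℝ) ^ p with hD
  have hD0 : 0 < D := by positivity
  set K : ℝ := 2 * (4 * M / Z) with hKdef
  have hK : 0 < K := by positivity
  have hKM : Real.exp (-K / 2) * M ≤ Z / 4 := by
    have h1 : 4 * M / Z ≤ Real.exp (4 * M / Z) := by linarith [Real.add_one_le_exp (4 * M / Z)]
    have h2 : -K / 2 = -(4 * M / Z) := by rw [hKdef]; ring
    rw [h2, Real.exp_neg, inv_mul_le_iff₀ (Real.exp_pos _)]
    rw [div_le_iff₀ hZ] at h1
    linarith
  set E : ℝ := 4 * Z * Real.exp (D + 1 / 2) with hE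
  have hE0 : 0 < E := by positivity
  set L : ℝ := max 1 (E ^ 2) with hL
  have hL1 : 1 ≤ L := le_max_left _ _
  have hlogL : 0 ≤ Real.log L := Real.log_nonneg hL1
  set τ : ℝ := 1 / (2 * D) with hτ
  have hτ0 : 0 < τ := by positivity
  set C1 : ℝ := 1 / 2 * (τ / K) ^ (1 / p) with hC1
  set C2 : ℝ := 1 / 2 * (1 / (1 + Real.log L)) ^ (1 / p) with hC2
  have hC10 : 0 < C1 := by positivity
  have hC20 : 0 < C2 := by positivity
  refine ⟨1 / (2 * L), min C1 C2, by positivity, ?_, lt_min hC10 hC20, ?_⟩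
  · rw [div_lt_one (by positivity)]; linarith
  intro n hn m hmn μ hμ
  have hn0 : (0 : ℝ) < n := by exact_mod_cast (by omega : 0 < n)
  have hm0 : (0 : ℝ) ≤ m := Nat.cast_nonneg m
  have hmn' : 2 * L * m ≤ n := by
    rw [div_mul_eq_mul_div, one_mul, le_div_iff₀ (by positivity)] at hmn
    linarith
  have hmle : m + 1 ≤ n := by
    have h1 : (2 * m : ℝ) ≤ n := by nlinarith
    have h2 : 2 * m ≤ n := by exact_mod_cast h1
    omega
  have hmle' : (m : ℝ) + 1 ≤ n := by exact_mod_cast hmle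
  set ℓ := Real.log (Real.exp 1 * n / ((m : ℝ) + 1)) with hℓ
  have hℓe : ℓ = 1 + Real.log (n / ((m : ℝ) + 1)) := by
    rw [hℓ, mul_div_assoc, Real.log_mul (Real.exp_pos 1).ne' (by positivity), Real.log_exp]
  have hℓ1 : 1 ≤ ℓ := by
    rw [hℓe]
    have : 0 ≤ Real.log (n / ((m : ℝ) + 1)) :=
      Real.log_nonneg (by rw [le_div_iff₀ (by positivity)]; linarith)
    linarith
  by_cases hcase : L * ((m : ℝ) + 1) ≤ n
  · have hv : 0 < τ * ℓ := by positivity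
    have hQ : 4 * ((m : ℝ) + 1) * Z ≤ n * ∫ t in {t : ℝ | τ * ℓ ≤ t ^ p}, phi p 1 t := by
      refine le_trans ?_ (mul_le_mul_of_nonneg_left (phi_tail hp hv.le) hn0.le)
      set y : ℝ := n / ((m : ℝ) + 1) with hy
      have hy0 : 0 < y := by positivity
      have hyE : E ^ 2 ≤ y := by
        rw [hy, le_div_iff₀ (by positivity)]
        refine le_trans ?_ hcase
        exact mul_le_mul_of_nonneg_right (le_max_right _ _) (by positivity)
      have hexp : -((2 : ℝ) ^ p * (τ * ℓ + 1)) = -(D + 1 / 2) + -(Real.log y / 2) := by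
        rw [hℓe, ← hD, hτ]; field_simp; ring
      have hsq : Real.exp (-(Real.log y / 2)) = (Real.sqrt y)⁻¹ := by
        rw [Real.exp_neg, Real.exp_half, Real.exp_log hy0]
      have hEs : E ≤ Real.sqrt y := Real.le_sqrt_of_sq_le hyE
      have hs0 : 0 < Real.sqrt y := by positivity
      have hny : (n : ℝ) = ((m : ℝ) + 1) * (Real.sqrt y * Real.sqrt y) := by
        rw [Real.mul_self_sqrt hy0.le, hy]; field_simp
      rw [hexp, Real.exp_add, hsq, Real.exp_neg]
      have h3 : (n : ℝ) * ((Real.exp (D + 1 / 2))⁻¹ * (Real.sqrt y)⁻¹) =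
          ((m : ℝ) + 1) * (Real.sqrt y * (Real.exp (D + 1 / 2))⁻¹) := by
        rw [hny]; field_simp
      rw [h3]
      have h4 : 4 * Z ≤ Real.sqrt y * (Real.exp (D + 1 / 2))⁻¹ := by
        rw [← div_eq_mul_inv, le_div_iff₀ (Real.exp_pos _)]; exact hEs
      calc 4 * ((m : ℝ) + 1) * Z = ((m : ℝ) + 1) * (4 * Z) := by ring
        _ ≤ _ := mul_le_mul_of_nonneg_left h4 (by positivity)
    refine le_trans ?_ (main_case hp hn hmle hv hK hKM hQ hμ)
    have h5 : τ * ℓ / (K * n) = τ / K * (ℓ / n) := by field_simp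
    rw [h5, Real.mul_rpow (by positivity) (by positivity), ← mul_assoc]
    exact mul_le_mul_of_nonneg_right (min_le_left _ _) (by positivity)
  · push Not at hcase
    have hm1 : (m : ℝ) < 1 := by nlinarith
    have hm2 : m = 0 := by
      have : m < 1 := by exact_mod_cast hm1
      omega
    subst hm2
    refine le_trans ?_ (small_case hp hn hμ)
    have hnL : (n : ℝ) ≤ L := by simpa using hcase.le
    have hℓL : ℓ ≤ 1 + Real.log L := by
      rw [hℓe]
      have := Real.log_le_log hn0 hnL
      simpa using this
    calc min C1 C2 * (ℓ / n) ^ (1 / p) ≤ C2 * (ℓ / n) ^ (1 / p) :=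
          mul_le_mul_of_nonneg_right (min_le_right _ _) (by positivity)
      _ = 1 / 2 * (1 / (1 + Real.log L) * (ℓ / n)) ^ (1 / p) := by
          rw [hC2, mul_assoc, Real.mul_rpow (by positivity) (by positivity)]
      _ ≤ 1 / 2 * (1 / (n : ℝ)) ^ (1 / p) := by
          apply mul_le_mul_of_nonneg_left _ (by norm_num)
          apply Real.rpow_le_rpow (by positivity) _ (by positivity)
          rw [div_mul_div_comm, one_mul, div_le_div_iff₀ (by positivity) hn0]
          nlinarith

end
end
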